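/- Let L = 2ⁿ with n ≥ 1 and consider Code 1 on Λ = (ℤ/Lℤ)³. For every site u there exists a finite sequence E₁,…,E_T of single-qubit Pauli operators (each of the form XI_v) with E_T⋯E₁ = E⁽ⁿ⁾_u such that for every t = 1,…,T the syndrome of E_t⋯E₁ (with respect to the generators of Code 1) contains at most 4n + 4 defects. Consequently, the logical operator E⁽ⁿ⁾_u of Code 1 has energy barrier at most 4 + 4·log₂ L. -/

import Mathlib

namespace BH

/-- The lattice `Λ = (ℤ/Lℤ)³`. -/
abbrev Site3 (L : ℕ) := Fin 3 → ZMod L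

/-- Pauli operators modulo phase on the qubits of Code 1 (two qubits per
site), written additively: `E = (Eˣ, Eᶻ)` componentwise over `𝔽₂ × 𝔽₂`. -/
abbrev Pauli1 (L : ℕ) := (Site3 L × Fin 2) → ZMod 2 × ZMod 2

/-- The symplectic form `ω(E,F) = Σ_q (Eˣ_q Fᶻ_q + Eᶻ_q Fˣ_q)`;
`E` and `F` commute iff `ω(E,F) = 0`, and anticommute iff `ω(E,F) = 1`. -/
def sympForm {L : ℕ} [NeZero L] (E F : Pauli1 L) : ZMod 2 :=
  ∑ q, ((E q).1 * (F q).2 + (E q).2 * (F q).1)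

/-- The lattice vector with given coordinates. -/
def vv {L : ℕ} (a b c : ℕ) : Site3 L := ![(a : ZMod L), (b : ZMod L), (c : ZMod L)]

/-- The `Z`-type generator `G^Z_c` of Code 1: `Z` on the first qubit of the
sites `c+(1,0,1), c+(1,1,1), c+(1,1,0), c+(0,1,1)` and `Z` on the second qubit
of the sites `c+(1,1,1), c+(1,0,0), c+(0,1,0), c+(0,0,1)`. -/
def GZ {L : ℕ} (c : Site3 L) : Pauli1 L := fun q =>
  if (q.2 = 0 ∧ (q.1 = c + vv 1 0 1 ∨ q.1 = c + vv 1 1 1 ∨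
        q.1 = c + vv 1 1 0 ∨ q.1 = c + vv 0 1 1)) ∨
     (q.2 = 1 ∧ (q.1 = c + vv 1 1 1 ∨ q.1 = c + vv 1 0 0 ∨
        q.1 = c + vv 0 1 0 ∨ q.1 = c + vv 0 0 1))
  then (0, 1) else (0, 0)

/-- The `X`-type generator `G^X_c` of Code 1: `X` on the first qubit of the
sites `c+(0,0,0), c+(1,0,1), c+(1,1,0), c+(0,1,1)` and `X` on the second qubit
of the sites `c+(0,0,0), c+(1,0,0), c+(0,1,0), c+(0,0,1)`. -/
def GX {L : ℕ} (c : Site3 L) : Pauli1 L := fun q =>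
  if (q.2 = 0 ∧ (q.1 = c + vv 0 0 0 ∨ q.1 = c + vv 1 0 1 ∨
        q.1 = c + vv 1 1 0 ∨ q.1 = c + vv 0 1 1)) ∨
     (q.2 = 1 ∧ (q.1 = c + vv 0 0 0 ∨ q.1 = c + vv 1 0 0 ∨
        q.1 = c + vv 0 1 0 ∨ q.1 = c + vv 0 0 1))
  then (1, 0) else (0, 0)

/-- The single-qubit Pauli operator `XI_u`: `X` on the first qubit of site `u`. -/
def XI {L : ℕ} (u : Site3 L) : Pauli1 L := fun q => if q = (u, 0) then (1, 0) else (0, 0)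

end BH

namespace BH

/-- The fractal Pauli error: `E⁽⁰⁾_u = XI_u` and
`E⁽ᵖ⁺¹⁾_u = E⁽ᵖ⁾_u · E⁽ᵖ⁾_{u+2ᵖx̂} · E⁽ᵖ⁾_{u+2ᵖŷ} · E⁽ᵖ⁾_{u+2ᵖẑ}`
(written additively). -/
def Efrac {L : ℕ} : ℕ → Site3 L → Pauli1 L
  | 0, u => XI u
  | p + 1, u =>
      Efrac p u + Efrac p (u + (2 ^ p : ZMod L) • vv 1 0 0)
        + Efrac p (u + (2 ^ p : ZMod L) • vv 0 1 0)
        + Efrac p (u + (2 ^ p : ZMod L) • vv 0 0 1)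

/-- The generators of Code 1, indexed by `Λ × Bool`: `Gen (c, false) = G^Z_c`
and `Gen (c, true) = G^X_c`. -/
def Gen {L : ℕ} (g : Site3 L × Bool) : Pauli1 L :=
  if g.2 then GX g.1 else GZ g.1

/-- The syndrome of a Pauli operator: the set of generators of Code 1 that
anticommute with it (its elements are the defects). -/
def syndrome1 {L : ℕ} [NeZero L] (E : Pauli1 L) : Finset (Site3 L × Bool) :=
  Finset.univ.filter fun g => sympForm (Gen g) E = 1


/-- The syndrome function. -/
def sg {L : ℕ} [NeZero L] (E : Pauli1 L) : Site3 L × Bool → ZMod 2 :=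
  fun g => sympForm (Gen g) E

/-- A point defect attached to the site `a`. -/
def ep {L : ℕ} (a : Site3 L) : Site3 L × Bool → ZMod 2 :=
  fun g => if g = (a - vv 1 1 1, false) then 1 else 0

lemma sg_zero {L : ℕ} [NeZero L] : sg (0 : Pauli1 L) = 0 := by
  funext g; simp [sg, sympForm]

lemma sg_add {L : ℕ} [NeZero L] (E F : Pauli1 L) : sg (E + F) = sg E + sg F := by
  funext g
  simp only [sg, sympForm, Pi.add_apply, ← Finset.sum_add_distrib]
  refine Finset.sum_congr rfl fun q _ => ?_
  simp only [Prod.fst_add, Prod.snd_add]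
  ring

lemma sympForm_XI {L : ℕ} [NeZero L] (G : Pauli1 L) (u : Site3 L) :
    sympForm G (XI u) = (G (u, 0)).2 := by
  unfold sympForm
  rw [Finset.sum_eq_single (u, 0)]
  · simp [XI]
  · intro b _ hb
    simp [XI, hb]
  · simp

lemma two_fun {L : ℕ} : (2 : Site3 L × Bool → ZMod 2) = 0 := by
  funext g; rfl

lemma aux_ite {P1 P2 P3 P4 Q : Prop} [Decidable P1] [Decidable P2] [Decidable P3]
    [Decidable P4] [Decidable Q] (hQ : Q ↔ P1 ∨ P2 ∨ P3 ∨ P4)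
    (n1 : P1 → P2 → False) (n2 : P1 → P3 → False) (n3 : P1 → P4 → False)
    (n4 : P3 → P2 → False) (n5 : P4 → P2 → False) (n6 : P3 → P4 → False) :
    (if Q then ((0, 1) : ZMod 2 × ZMod 2) else (0, 0)).2 =
      (if P1 then 1 else 0) + (if P2 then 1 else 0) + (if P3 then 1 else 0)
        + (if P4 then 1 else 0) := by
  by_cases h1 : P1 <;> by_cases h2 : P2 <;> by_cases h3 : P3 <;> by_cases h4 : P4 <;>
    simp_all

lemma sg_XI {L : ℕ} [NeZero L] (hL : (1 : ZMod L) ≠ 0) (u : Site3 L) :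
    sg (XI u) = ep u + ep (u + vv 1 0 0) + ep (u + vv 0 1 0) + ep (u + vv 0 0 1) := by
  funext ⟨c, b⟩
  simp only [sg, sympForm_XI, Pi.add_apply, ep]
  cases b
  · have e1 : (u = c + vv 1 1 1) ↔ (c = u - vv 1 1 1) := by
      constructor <;> rintro rfl <;> abel
    have e2 : (u = c + vv 0 1 1) ↔ (c = u + vv 1 0 0 - vv 1 1 1) := by
      have : (vv 1 1 1 : Site3 L) = vv 1 0 0 + vv 0 1 1 := by
        funext i; fin_cases i <;> simp [vv]
      rw [this]
      constructor <;> rintro rfl <;> abel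
    have e3 : (u = c + vv 1 0 1) ↔ (c = u + vv 0 1 0 - vv 1 1 1) := by
      have : (vv 1 1 1 : Site3 L) = vv 0 1 0 + vv 1 0 1 := by
        funext i; fin_cases i <;> simp [vv]
      rw [this]
      constructor <;> rintro rfl <;> abel
    have e4 : (u = c + vv 1 1 0) ↔ (c = u + vv 0 0 1 - vv 1 1 1) := by
      have : (vv 1 1 1 : Site3 L) = vv 0 0 1 + vv 1 1 0 := by
        funext i; fin_cases i <;> simp [vv]
      rw [this]
      constructor <;> rintro rfl <;> abel
    have hne : ∀ x y : Site3 L, x ≠ y → u = c + x → u = c + y → False := by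
      intro x y hxy h1 h2
      exact hxy (add_left_cancel (h1.symm.trans h2))
    have n1 := hne (vv 1 1 1) (vv 0 1 1) (fun h => hL (by simpa [vv] using congrFun h 0))
    have n2 := hne (vv 1 1 1) (vv 1 0 1) (fun h => hL (by simpa [vv] using congrFun h 1))
    have n3 := hne (vv 1 1 1) (vv 1 1 0) (fun h => hL (by simpa [vv] using congrFun h 2))
    have n4 := hne (vv 1 0 1) (vv 0 1 1) (fun h => hL (by simpa [vv] using congrFun h 0))
    have n5 := hne (vv 1 1 0) (vv 0 1 1) (fun h => hL (by simpa [vv] using congrFun h 0))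
    have n6 := hne (vv 1 0 1) (vv 1 1 0) (fun h => hL (by simpa [vv] using (congrFun h 2)))
    have hG : (Gen (c, false) : Pauli1 L) = GZ c := rfl
    rw [hG]
    simp only [GZ, Prod.mk.injEq, and_true, ← e1, ← e2, ← e3, ← e4]
    refine aux_ite ?_ n1 n2 n3 n4 n5 n6
    clear n1 n2 n3 n4 n5 n6 hne e1 e2 e3 e4 hG
    constructor
    · rintro (⟨-, h | h | h | h⟩ | ⟨h, -⟩)
      · exact Or.inr (Or.inr (Or.inl h))
      · exact Or.inl h
      · exact Or.inr (Or.inr (Or.inr h))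
      · exact Or.inr (Or.inl h)
      · exact absurd h (by decide)
    · rintro (h | h | h | h)
      · exact Or.inl ⟨trivial, Or.inr (Or.inl h)⟩
      · exact Or.inl ⟨trivial, Or.inr (Or.inr (Or.inr h))⟩
      · exact Or.inl ⟨trivial, Or.inl h⟩
      · exact Or.inl ⟨trivial, Or.inr (Or.inr (Or.inl h))⟩
  · have hG : (Gen (c, true) : Pauli1 L) = GX c := rfl
    rw [hG]
    have : (GX c (u, 0)).2 = 0 := by
      unfold GX; split_ifs <;> rfl
    rw [this]; simp

lemma sg_Efrac {L : ℕ} [NeZero L] (hL : (1 : ZMod L) ≠ 0) (p : ℕ) (u : Site3 L) :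
    sg (Efrac p u) = ep u + ep (u + (2 ^ p : ZMod L) • vv 1 0 0)
      + ep (u + (2 ^ p : ZMod L) • vv 0 1 0) + ep (u + (2 ^ p : ZMod L) • vv 0 0 1) := by
  induction p generalizing u with
  | zero => simpa [Efrac] using sg_XI hL u
  | succ p ih =>
    have hd : ∀ x : Site3 L, u + (2 ^ (p + 1) : ZMod L) • x
        = u + (2 ^ p : ZMod L) • x + (2 ^ p : ZMod L) • x := by
      intro x; rw [add_assoc, ← add_smul, pow_succ, mul_two]
    simp only [Efrac, sg_add, ih, hd]
    generalize (2 ^ p : ZMod L) • (vv 1 0 0 : Site3 L) = X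
    generalize (2 ^ p : ZMod L) • (vv 0 1 0 : Site3 L) = Y
    generalize (2 ^ p : ZMod L) • (vv 0 0 1 : Site3 L) = Z
    rw [add_right_comm u Y X, add_right_comm u Z X, add_right_comm u Z Y]
    linear_combination (ep (u + X) + ep (u + Y) + ep (u + Z) + ep (u + X + Y) + ep (u + X + Z)
      + ep (u + Y + Z)) * (two_fun (L := L))

/-- `f` is a point defect at `w` plus at most `k` further point defects. -/
def DD {L : ℕ} (f : Site3 L × Bool → ZMod 2) (w : Site3 L) (k : ℕ) : Prop :=
  ∃ m : List (Site3 L), m.length ≤ k ∧ f = ep w + (m.map ep).sum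

/-- Every nonempty prefix of `l` has few defects, one of them at `w`. -/
def Good {L : ℕ} [NeZero L] (l : List (Site3 L)) (w : Site3 L) (k : ℕ) : Prop :=
  ∀ q, q <+: l → q ≠ [] → DD (sg (q.map XI).sum) w k

lemma Good.append {L : ℕ} [NeZero L] {A B : List (Site3 L)} {w w' : Site3 L} {j k : ℕ}
    (hA : Good A w k) (hB : Good B w' j)
    (h : ∀ f, DD f w' j → DD (sg (A.map XI).sum + f) w k) : Good (A ++ B) w k := by
  intro q hq hne
  obtain ⟨r, hr⟩ := hq
  rcases List.append_eq_append_iff.1 hr with ⟨s, h1, h2⟩ | ⟨s, h1, h2⟩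
  · exact hA q ⟨s, h1.symm⟩ hne
  · by_cases hs : s = []
    · subst hs
      exact hA q (by simp [h1]) hne
    · have := h _ (hB s ⟨r, h2.symm⟩ hs)
      rw [h1, List.map_append, List.sum_append, sg_add]
      exact this

lemma DD.mono {L : ℕ} {f : Site3 L × Bool → ZMod 2} {w : Site3 L} {j k : ℕ}
    (h : DD f w j) (hjk : j ≤ k) : DD f w k := by
  obtain ⟨m, hm, e⟩ := h
  exact ⟨m, hm.trans hjk, e⟩

lemma exists_good {L : ℕ} [NeZero L] (hL : (1 : ZMod L) ≠ 0) (p : ℕ) (u : Site3 L) :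
    ∃ l : List (Site3 L), (l.map XI).sum = Efrac p u ∧ Good l u (4 * p + 3) := by
  induction p generalizing u with
  | zero =>
    refine ⟨[u], by simp [Efrac], ?_⟩
    intro q hq hne
    have : q = [u] := by
      obtain ⟨r, hr⟩ := hq
      cases q with
      | nil => exact absurd rfl hne
      | cons a t => simp at hr; simp [hr]
    subst this
    refine ⟨[u + vv 1 0 0, u + vv 0 1 0, u + vv 0 0 1], by simp, ?_⟩
    simp only [List.map_cons, List.map_nil, List.sum_cons, List.sum_nil, add_zero, sg_XI hL]
    ring
  | succ p ih =>
    have hs := sg_Efrac hL p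
    simp only [Efrac]
    generalize (2 ^ p : ZMod L) • (vv 1 0 0 : Site3 L) = X at *
    generalize (2 ^ p : ZMod L) • (vv 0 1 0 : Site3 L) = Y at *
    generalize (2 ^ p : ZMod L) • (vv 0 0 1 : Site3 L) = Z at *
    obtain ⟨A, eA, gA⟩ := ih u
    obtain ⟨B, eB, gB⟩ := ih (u + X)
    obtain ⟨C, eC, gC⟩ := ih (u + Y)
    obtain ⟨D, eD, gD⟩ := ih (u + Z)
    refine ⟨A ++ B ++ C ++ D, by simp only [List.map_append, List.sum_append, eA, eB, eC, eD], ?_⟩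
    refine Good.append (Good.append (Good.append ?_ gB ?_) gC ?_) gD ?_
    · exact fun q h1 h2 => (gA q h1 h2).mono (by omega)
    · rintro f ⟨m, hm, rfl⟩
      refine ⟨(u + Y) :: (u + Z) :: m, by simp; omega, ?_⟩
      simp only [List.map_cons, List.sum_cons, eA, hs]
      linear_combination ep (u + X) * (two_fun (L := L))
    · rintro f ⟨m, hm, rfl⟩
      refine ⟨(u + X + X) :: (u + Z) :: (u + X + Y) :: (u + X + Z) :: m, by simp; omega, ?_⟩
      simp only [List.map_cons, List.sum_cons, List.map_append, List.sum_append, eA, eB, sg_add, hs]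
      linear_combination (ep (u + X) + ep (u + Y)) * (two_fun (L := L))
    · rintro f ⟨m, hm, rfl⟩
      refine ⟨(u + X + X) :: (u + Y + Y) :: (u + X + Z) :: (u + Y + Z) :: m, by simp; omega, ?_⟩
      simp only [List.map_cons, List.sum_cons, List.map_append, List.sum_append, eA, eB, eC,
        sg_add, hs]
      rw [add_right_comm u Y X]
      linear_combination (ep (u + X) + ep (u + Y) + ep (u + Z) + ep (u + X + Y))
        * (two_fun (L := L))

lemma mem_of_ep_sum {L : ℕ} (m : List (Site3 L)) (g : Site3 L × Bool)
    (h : (m.map ep).sum g ≠ 0) : g ∈ m.map fun a => (a - vv 1 1 1, false) := by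
  induction m with
  | nil => simp at h
  | cons a m ih =>
    by_cases hg : g = (a - vv 1 1 1, false)
    · simp [hg]
    · have : ep a g = 0 := by simp [ep, hg]
      rw [List.map_cons, List.sum_cons, Pi.add_apply, this, zero_add] at h
      rw [List.map_cons]
      exact List.mem_cons_of_mem _ (ih h)

lemma card_le_of_DD {L : ℕ} [NeZero L] (E : Pauli1 L) (w : Site3 L) (k : ℕ)
    (h : DD (sg E) w k) : (syndrome1 E).card ≤ k + 1 := by
  classical
  obtain ⟨m, hm, e⟩ := h
  have hsub : syndrome1 E ⊆ ((w :: m).map fun a => (a - vv 1 1 1, false)).toFinset := by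
    intro g hg
    rw [List.mem_toFinset]
    apply mem_of_ep_sum
    have h1 : sg E g = 1 := by simpa [syndrome1, sg] using hg
    rw [List.map_cons, List.sum_cons, ← e, h1]
    exact one_ne_zero
  refine (Finset.card_le_card hsub).trans ((List.toFinset_card_le _).trans ?_)
  simp; omega

lemma sum_take {M : Type*} [AddCommMonoid M] {α : Type*} (f : α → M) (l : List α) (t : ℕ) :
    (∑ s : Fin l.length, if (s : ℕ) ≤ t then f (l.get s) else 0)
      = ((l.take (t + 1)).map f).sum := by
  induction l generalizing t with
  | nil => simp
  | cons a l ih =>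
    simp only [List.length_cons]
    rw [Fin.sum_univ_succ]
    cases t with
    | zero => simp
    | succ t => simpa using congrArg (f a + ·) (ih t)

/-- Let `L = 2ⁿ`, `n ≥ 1`, and consider Code 1 on
`(ℤ/Lℤ)³`. For every site `u` there is a finite sequence `E₁,…,E_T` of
single-qubit Pauli operators, each of the form `XI_v`, whose product is
`E⁽ⁿ⁾_u`, such that every partial product `E_t⋯E₁` has a syndrome with at most
`4n + 4` defects. Consequently the logical operator `E⁽ⁿ⁾_u` has energy
barrier at most `4 + 4·log₂ L`. -/
theorem Efrac_energy_barrier (n L : ℕ) [NeZero L] (hL : L = 2 ^ n) (hn : 1 ≤ n)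
    (u : Site3 L) :
    ∃ (T : ℕ) (v : Fin T → Site3 L),
      (∑ t : Fin T, XI (v t)) = Efrac n u ∧
      ∀ t : Fin T,
        (syndrome1 (∑ s : Fin T, if s ≤ t then XI (v s) else 0)).card ≤ 4 * n + 4 := by
  have h1 : (1 : ZMod L) ≠ 0 := by
    have : Fact (1 < L) := ⟨by rw [hL]; exact Nat.one_lt_two_pow (by omega)⟩
    exact one_ne_zero
  obtain ⟨l, e, g⟩ := exists_good h1 n u
  refine ⟨l.length, l.get, ?_, ?_⟩
  · rw [← e, ← List.sum_ofFn]
    congr 1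
    rw [← Function.comp_def, ← List.map_ofFn, List.ofFn_get]
  · intro t
    have := sum_take XI l t
    simp only [Fin.le_def]
    rw [this]
    refine card_le_of_DD _ u (4 * n + 3) (g _ (List.take_prefix _ _) ?_)
    have := t.2
    intro h0
    have h2 := congrArg List.length h0
    rw [List.length_take, List.length_nil] at h2
    omega

end BH
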